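/- If every advertiser's keyword-valuation vector is i.i.d. drawn from an MHR distribution T, and r is the Myerson reserve price vector (φ_s(r_s) = 0 for each keyword s), then E_v[R_r^{PBM-VCG}(v)] ≥ (1/e) · E_v[SW(𝔳)]; that is, the expected revenue of PBM-VCG with Myerson reserves is at least a 1/e fraction of the expected welfare of the truthful keyword allocation. -/

import Mathlib

open Finset MeasureTheory

noncomputable section

namespace PBM

attribute [local instance] Classical.propDecidable

/-- 0-indexed rank of advertiser `i` among the advertisers with a positive bid
(higher bid first, ties broken by smaller index). -/
def rank {n : ℕ} (bs : Fin n → ℝ) (i : Fin n) : ℕ :=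
  (Finset.univ.filter fun j => 0 < bs j ∧ (bs i < bs j ∨ (bs j = bs i ∧ j < i))).card

/-- 0-indexed rank of `i` among all coordinates of `x` (decreasing, ties by index). -/
def rankAll {n : ℕ} (x : Fin n → ℝ) (i : Fin n) : ℕ :=
  (Finset.univ.filter fun j => x i < x j ∨ (x j = x i ∧ j < i)).card

/-- click probability of the slot obtained by `i` (0 if `i` places no positive bid). -/
def slotW {n : ℕ} (w : ℕ → ℝ) (bs : Fin n → ℝ) (i : Fin n) : ℝ :=
  if 0 < bs i then w (rank bs i) else 0

/-- GSP per-click payment of `i`: the bid of the advertiser ranked right below `i`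
(0 if there is none). -/
def pay {n : ℕ} (bs : Fin n → ℝ) (i : Fin n) : ℝ :=
  ∑ j ∈ Finset.univ.filter (fun j => 0 < bs j ∧ rank bs j = rank bs i + 1), bs j

/-- utility of bidder `i` in the single-keyword GSP game with values `vv`. -/
def gspUtil {n : ℕ} (w : ℕ → ℝ) (vv : Fin n → ℝ) (bs : Fin n → ℝ) (i : Fin n) : ℝ :=
  slotW w bs i * (vv i - pay bs i)

variable {Q S : Type*} [Fintype Q] [Fintype S]

/-- expected value of keyword `s` for an advertiser with per-query valuations `vq`. -/
def kwVal (P : Q → ℝ) (pi : Q → S → ℝ) (vq : Q → ℝ) (s : S) : ℝ :=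
  (∑ q, pi q s * vq q * P q) / (∑ q, pi q s * P q)

/-- probability mass of keyword `s`. -/
def mass (P : Q → ℝ) (pi : Q → S → ℝ) (s : S) : ℝ := ∑ q, pi q s * P q

/-- expected utility of advertiser `i` in PBM-GSP. -/
def util {n : ℕ} (P : Q → ℝ) (pi : Q → S → ℝ) (w : ℕ → ℝ)
    (v : Fin n → Q → ℝ) (b : Fin n → S → ℝ) (i : Fin n) : ℝ :=
  ∑ q, P q * ∑ s, pi q s *
    (slotW w (fun j => b j s) i * (v i q - pay (fun j => b j s) i))

/-- social welfare of bid profile `b` in PBM-GSP. -/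
def SW {n : ℕ} (P : Q → ℝ) (pi : Q → S → ℝ) (w : ℕ → ℝ)
    (v : Fin n → Q → ℝ) (b : Fin n → S → ℝ) : ℝ :=
  ∑ q, P q * ∑ s, pi q s * ∑ i, slotW w (fun j => b j s) i * v i q

/-- optimal social welfare. -/
def SWopt {n : ℕ} (P : Q → ℝ) (w : ℕ → ℝ) (v : Fin n → Q → ℝ) : ℝ :=
  ∑ q, P q * ∑ i, w (rankAll (fun j => v j q) i) * v i q

/-- welfare of the truthful keyword-bid profile `𝔳` (each advertiser bids his
expected keyword value on every keyword, no `κ` constraint). -/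
def SWtruth {n : ℕ} (P : Q → ℝ) (pi : Q → S → ℝ) (w : ℕ → ℝ)
    (v : Fin n → Q → ℝ) : ℝ :=
  ∑ q, P q * ∑ s, pi q s *
    ∑ i, w (rankAll (fun j => kwVal P pi (v j) s) i) * kwVal P pi (v i) s

/-- a bid vector is valid if it is nonnegative and positive on at most `κ` keywords. -/
def ValidBid (κ : ℕ) (bi : S → ℝ) : Prop :=
  (∀ s, 0 ≤ bi s) ∧ ((Finset.univ.filter fun s => 0 < bi s).card ≤ κ)

/-- a bid profile is conservative if everybody bids at most his expected keyword value. -/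
def Conservative {n : ℕ} (P : Q → ℝ) (pi : Q → S → ℝ)
    (v : Fin n → Q → ℝ) (b : Fin n → S → ℝ) : Prop :=
  ∀ i s, b i s ≤ kwVal P pi (v i) s

/-- `β`-keyword-level expressiveness for valuation profile `v`. -/
def KLExpressive {n : ℕ} (pi : Q → S → ℝ) (v : Fin n → Q → ℝ) (κ : ℕ) (β : ℝ) : Prop :=
  ∀ i : Fin n,
    β * ((Finset.univ.filter fun s : S => ∃ q, 0 < pi q s ∧ 0 < v i q).card : ℝ) ≤ (κ : ℝ)

/-- expected utility of advertiser `i` in PBM-GSP with reserve price vector `r`. -/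
def utilR {n : ℕ} (P : Q → ℝ) (pi : Q → S → ℝ) (w : ℕ → ℝ) (r : S → ℝ)
    (v : Fin n → Q → ℝ) (b : Fin n → S → ℝ) (i : Fin n) : ℝ :=
  ∑ q, P q * ∑ s, pi q s *
    (if 0 < b i s ∧ r s ≤ b i s then
       w (rank (fun j => b j s) i) * (v i q - max (r s) (pay (fun j => b j s) i))
     else 0)

/-- revenue of PBM-GSP with reserve price vector `r`. -/
def revenue {n : ℕ} (P : Q → ℝ) (pi : Q → S → ℝ) (w : ℕ → ℝ) (r : S → ℝ)
    (b : Fin n → S → ℝ) : ℝ :=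
  ∑ q, P q * ∑ s, pi q s * ∑ i,
    (if 0 < b i s ∧ r s ≤ b i s then
       w (rank (fun j => b j s) i) * max (r s) (pay (fun j => b j s) i)
     else 0)

/-- reserve-restricted social welfare of PBM-GSP with reserve price vector `r`. -/
def SWres {n : ℕ} (P : Q → ℝ) (pi : Q → S → ℝ) (w : ℕ → ℝ) (r : S → ℝ)
    (v : Fin n → Q → ℝ) (b : Fin n → S → ℝ) : ℝ :=
  ∑ q, P q * ∑ s, pi q s * ∑ i,
    (if 0 < b i s ∧ r s ≤ b i s then w (rank (fun j => b j s) i) * v i q else 0)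

/-- marginal CDF on keyword `s` of a distribution `T` of keyword-valuation vectors. -/
def cdfT (T : Measure (S → ℝ)) (s : S) (x : ℝ) : ℝ :=
  ((T.map fun f => f s) (Set.Iic x)).toReal

/-- the virtual value function `φ_s(x) = x - (1 - T_s(x))/t_s(x)`. -/
def virt (T : Measure (S → ℝ)) (td : S → ℝ → ℝ) (s : S) (x : ℝ) : ℝ :=
  x - (1 - cdfT T s x) / td s x

/-- `td s` is the density of the marginal of `T` on keyword `s`. -/
def HasDensity (T : Measure (S → ℝ)) (td : S → ℝ → ℝ) : Prop :=
  ∀ s : S, T.map (fun f => f s)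
    = MeasureTheory.volume.withDensity (fun x => ENNReal.ofReal (td s x))

/-- `r` is the vector of Myerson reserve prices. -/
def MyersonReserve (T : Measure (S → ℝ)) (td : S → ℝ → ℝ) (r : S → ℝ) : Prop :=
  ∀ s : S, 0 ≤ r s ∧ virt T td s (r s) = 0

/-- `T` is an MHR distribution with bounded derivative `η`. -/
def MHRBounded (T : Measure (S → ℝ)) (td : S → ℝ → ℝ) (r : S → ℝ) (η : ℝ) : Prop :=
  ∀ s : S, (∀ x : ℝ, 0 ≤ x → DifferentiableAt ℝ (virt T td s) x) ∧
    (∀ x : ℝ, 0 ≤ x → 1 ≤ deriv (virt T td s) x) ∧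
    (∀ x : ℝ, r s ≤ x → deriv (virt T td s) x ≤ η)

/-- `T` has a monotone hazard rate. -/
def MHRhazard (T : Measure (S → ℝ)) (td : S → ℝ → ℝ) : Prop :=
  ∀ s : S, MonotoneOn (fun x => td s x / (1 - cdfT T s x))
    {x : ℝ | 0 ≤ x ∧ cdfT T s x < 1}

/-- expected revenue (per valuation profile) of PBM-VCG with reserve prices, via
Myerson's lemma: virtual-value surplus of the welfare-maximizing allocation. -/
def revVCG {n : ℕ} (P : Q → ℝ) (pi : Q → S → ℝ) (w : ℕ → ℝ)
    (T : Measure (S → ℝ)) (td : S → ℝ → ℝ) (v : Fin n → Q → ℝ) : ℝ :=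
  ∑ s, mass P pi s * ∑ i, w (rankAll (fun j => kwVal P pi (v j) s) i) *
    (if 0 < virt T td s (kwVal P pi (v i) s) then virt T td s (kwVal P pi (v i) s) else 0)

end PBM

section HazardRate

variable {ν : Measure ℝ} [IsProbabilityMeasure ν] {t : ℝ → ℝ}

/-- The nonnegative part of the region where the survival function of `ν` is positive. -/
def hazardDomain (ν : Measure ℝ) : Set ℝ := {x | 0 ≤ x ∧ 0 < ν.real (Set.Ioi x)}


lemma measureReal_Ioi_antitone (ν : Measure ℝ) [IsProbabilityMeasure ν] :
    Antitone fun x => ν.real (Set.Ioi x) :=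
  fun _ _ h => measureReal_mono (Set.Ioi_subset_Ioi h)

lemma continuous_measureReal_Ioi (ν : Measure ℝ) [IsProbabilityMeasure ν] [NullSingletonClass ν] :
    Continuous fun x => ν.real (Set.Ioi x) := by
  have hc : Continuous (ProbabilityTheory.cdf ν) := by
    rw [continuous_iff_continuousAt]
    intro x
    rw [(ProbabilityTheory.cdf ν).mono.continuousAt_iff_leftLim_eq_rightLim,
      StieltjesFunction.rightLim_eq]
    have h := (ProbabilityTheory.cdf ν).measure_singleton x
    rw [ProbabilityTheory.measure_cdf, measure_singleton] at h
    have h1 := (ProbabilityTheory.cdf ν).mono.leftLim_le (le_refl x)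
    have h2 := ENNReal.ofReal_eq_zero.1 h.symm
    linarith
  have : (fun x => ν.real (Set.Ioi x)) = fun x => 1 - ProbabilityTheory.cdf ν x := by
    ext x
    rw [ProbabilityTheory.cdf_eq_real, ← Set.compl_Iic, probReal_compl_eq_one_sub measurableSet_Iic]
  rw [this]
  fun_prop

lemma measureReal_Ioi_of_nonpos [NullSingletonClass ν] (h0 : ν (Set.Iio 0) = 0) {x : ℝ} (hx : x ≤ 0) :
    ν.real (Set.Ioi x) = 1 := by
  rw [← Set.compl_Iic, probReal_compl_eq_one_sub measurableSet_Iic]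
  have h : ν (Set.Iic x) = 0 := by
    rw [← Iio_ae_eq_Iic.measure_eq]
    exact measure_mono_null (Set.Iio_subset_Iio hx) h0
  simp [measureReal_def, h]

lemma hazardDomain_ordConnected (ν : Measure ℝ) [IsProbabilityMeasure ν] :
    (hazardDomain ν).OrdConnected :=
  ⟨fun _ hx _ hy _ hz => ⟨hx.1.trans hz.1, hy.2.trans_le (measureReal_Ioi_antitone ν hz.2)⟩⟩

lemma mem_hazardDomain_of_le {x y : ℝ} (hx : 0 ≤ x) (hxy : x ≤ y) (hy : y ∈ hazardDomain ν) :
    x ∈ hazardDomain ν :=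
  ⟨hx, hy.2.trans_le (measureReal_Ioi_antitone ν hxy)⟩

lemma measurableSet_hazardDomain (ν : Measure ℝ) [IsProbabilityMeasure ν] :
    MeasurableSet (hazardDomain ν) :=
  (hazardDomain_ordConnected ν).measurableSet

lemma measure_compl_hazardDomain [NullSingletonClass ν] (h0 : ν (Set.Iio 0) = 0) :
    ν (hazardDomain ν)ᶜ = 0 := by
  set Z : Set ℝ := {x | ν.real (Set.Ioi x) = 0} with hZ
  have hsub : (hazardDomain ν)ᶜ ⊆ Set.Iio 0 ∪ Z := by
    intro x hx
    by_cases h : x < 0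
    · exact Or.inl h
    · right
      by_contra h'
      exact hx ⟨not_lt.1 h, lt_of_le_of_ne measureReal_nonneg (Ne.symm h')⟩
  refine measure_mono_null hsub (measure_union_null h0 ?_)
  rcases Z.eq_empty_or_nonempty with he | hne
  · simp [he]
  have hclosed : IsClosed Z := isClosed_eq (continuous_measureReal_Ioi ν) continuous_const
  have hbdd : BddBelow Z := by
    refine ⟨0, fun x hx => ?_⟩
    by_contra h
    have h1 := measureReal_Ioi_of_nonpos h0 (not_le.1 h).le
    have h2 : ν.real (Set.Ioi x) = 0 := hx
    linarith
  have hmem : ν.real (Set.Ioi (sInf Z)) = 0 := hclosed.csInf_mem hne hbdd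
  have : ν (Set.Ici (sInf Z)) = 0 := by
    rw [← Ioi_ae_eq_Ici.measure_eq]
    exact (measureReal_eq_zero_iff).1 hmem
  exact measure_mono_null (fun x hx => csInf_le hbdd hx) this

lemma eq_withDensity_restrict_hazardDomain [NullSingletonClass ν]
    (hd : ν = volume.withDensity fun x => ENNReal.ofReal (t x)) (h0 : ν (Set.Iio 0) = 0) :
    ν = (volume.restrict (hazardDomain ν)).withDensity fun x => ENNReal.ofReal (t x) := by
  rw [← restrict_withDensity (measurableSet_hazardDomain ν), ← hd]
  exact (Measure.restrict_eq_self_of_ae_mem (by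
    rw [ae_iff]; exact measure_compl_hazardDomain h0)).symm

lemma exists_pos_mem_hazardDomain [NullSingletonClass ν] (h0 : ν (Set.Iio 0) = 0) :
    ∃ x ∈ hazardDomain ν, 0 < x := by
  have h1 : ∀ᶠ x in nhds (0 : ℝ), 0 < ν.real (Set.Ioi x) := by
    have := (continuous_measureReal_Ioi ν).continuousAt (x := 0)
    refine this.eventually (lt_mem_nhds ?_)
    beta_reduce
    rw [measureReal_Ioi_of_nonpos h0 le_rfl]
    exact one_pos
  have h2 : ∀ᶠ x in nhdsWithin (0 : ℝ) (Set.Ioi 0), 0 < ν.real (Set.Ioi x) ∧ 0 < x :=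
    (h1.filter_mono nhdsWithin_le_nhds).and self_mem_nhdsWithin
  obtain ⟨x, hx, hx0⟩ := h2.exists
  exact ⟨x, ⟨hx0.le, hx⟩, hx0⟩

/-- A nondecreasing hazard rate crosses the hyperbola `x ↦ 1 / x` exactly once. -/
lemma exists_hazard_crossing [NullSingletonClass ν]
    (hd : ν = volume.withDensity fun x => ENNReal.ofReal (t x)) (h0 : ν (Set.Iio 0) = 0)
    (hM : MonotoneOn (fun x => t x / ν.real (Set.Ioi x)) (hazardDomain ν)) :
    ∃ p, 0 < p ∧ (∀ x ∈ hazardDomain ν, x < p → t x / ν.real (Set.Ioi x) ≤ 1 / p) ∧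
      (∀ x ∈ hazardDomain ν, p < x → 1 / p ≤ t x / ν.real (Set.Ioi x)) := by
  set h : ℝ → ℝ := fun x => t x / ν.real (Set.Ioi x) with hh
  set A : Set ℝ := {x | x ∈ hazardDomain ν ∧ x * h x ≤ 1} with hA
  have h0A : (0 : ℝ) ∈ A :=
    ⟨⟨le_rfl, by rw [measureReal_Ioi_of_nonpos h0 le_rfl]; exact one_pos⟩, by simp⟩
  have hdown : ∀ {x y : ℝ}, 0 ≤ x → x ≤ y → y ∈ A → x ∈ A := by
    intro x y hx hxy hy
    have hxI := mem_hazardDomain_of_le hx hxy hy.1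
    refine ⟨hxI, ?_⟩
    have h1 : h x ≤ h y := hM hxI hy.1 hxy
    rcases le_or_gt (h x) 0 with h2 | h2
    · nlinarith
    · exact (mul_le_mul hxy h1 h2.le (hx.trans hxy)).trans hy.2
  have hbdd : BddAbove A := by
    by_contra hb
    rw [not_bddAbove_iff] at hb
    have hall : ∀ x, 0 ≤ x → x ∈ A := fun x hx => by
      obtain ⟨y, hy, hxy⟩ := hb x
      exact hdown hx hxy.le hy
    have hneg : ∀ x ∈ hazardDomain ν, t x ≤ 0 := by
      intro x hx
      by_contra hpos
      have hp : 0 < h x := div_pos (not_le.1 hpos) hx.2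
      have hy0 : 0 ≤ max x (2 / h x) := le_max_of_le_left hx.1
      have hyA := hall _ hy0
      have h1 : h x ≤ h (max x (2 / h x)) := hM hx hyA.1 (le_max_left _ _)
      have h2 : 2 / h x * h x = 2 := by field_simp
      have h3 := le_max_right x (2 / h x)
      have h4 := hyA.2
      nlinarith [mul_le_mul h3 h1 hp.le hy0]
    have hz : ν Set.univ = 0 := by
      rw [eq_withDensity_restrict_hazardDomain hd h0, withDensity_apply _ MeasurableSet.univ,
        Measure.restrict_univ, setLIntegral_congr_fun (g := fun _ => 0)
          (measurableSet_hazardDomain ν) (fun x hx => ENNReal.ofReal_eq_zero.2 (hneg x hx))]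
      simp
    simp at hz
  have hp0 : 0 ≤ sSup A := le_csSup hbdd h0A
  have hbelow : ∀ y, 0 ≤ y → y < sSup A → y ∈ A := fun y hy hyp => by
    obtain ⟨a, ha, hya⟩ := exists_lt_of_lt_csSup ⟨0, h0A⟩ hyp
    exact hdown hy hya.le ha
  have habove : ∀ x ∈ hazardDomain ν, ∀ y, sSup A < y → y ≤ x → 1 < y * h x := by
    intro x hx y hpy hyx
    have hy0 := hp0.trans hpy.le
    have hyI := mem_hazardDomain_of_le hy0 hyx hx
    have h1 : h y ≤ h x := hM hyI hx hyx
    have h2 : 1 < y * h y := by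
      by_contra h'
      exact absurd (le_csSup hbdd ⟨hyI, not_lt.1 h'⟩) (not_le.2 hpy)
    nlinarith
  have hpos : 0 < sSup A := by
    refine lt_of_le_of_ne hp0 fun he => ?_
    obtain ⟨x, hx, hx0⟩ := exists_pos_mem_hazardDomain h0
    have hhx : 0 < h x := by
      have := habove x hx x (he ▸ hx0) le_rfl
      by_contra h'
      nlinarith
    have := habove x hx (min x (1 / h x)) (he ▸ lt_min hx0 (by positivity)) (min_le_left _ _)
    have h2 : 1 / h x * h x = 1 := by field_simp
    nlinarith [min_le_right x (1 / h x)]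
  refine ⟨sSup A, hpos, fun x hx hxp => ?_, fun x hx hpx => ?_⟩
  · change h x ≤ _
    rw [le_div_iff₀ hpos]
    by_contra hcon
    have hhx : 0 < h x := by
      by_contra h'
      nlinarith
    have h1 : 1 / h x < sSup A := by
      rw [div_lt_iff₀ hhx]; linarith
    obtain ⟨y, hy1, hy2⟩ := exists_between (max_lt hxp h1)
    have hxy := (le_max_left _ _).trans hy1.le
    have hyA := hbelow y (hx.1.trans hxy) hy2
    have h3 : h x ≤ h y := hM hx hyA.1 hxy
    have h4 : 1 < y * h x := by
      have := (le_max_right _ _).trans_lt hy1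
      rwa [div_lt_iff₀ hhx] at this
    nlinarith [hyA.2, hx.1.trans hxy]
  · change _ ≤ h x
    rw [div_le_iff₀ hpos]
    by_contra hcon
    have hhx : 0 < h x := by
      have := habove x hx x hpx le_rfl
      by_contra h'
      nlinarith
    have h1 : sSup A < 1 / h x := by
      rw [lt_div_iff₀ hhx]; linarith
    have := habove x hx (min x (1 / h x)) (lt_min hpx h1) (min_le_left _ _)
    have h2 : 1 / h x * h x = 1 := by field_simp
    nlinarith [min_le_right x (1 / h x)]

lemma measure_inter_hazardDomain_eq_lintegral [NullSingletonClass ν]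
    (hd : ν = volume.withDensity fun x => ENNReal.ofReal (t x)) (h0 : ν (Set.Iio 0) = 0)
    {B : Set ℝ} (hB : MeasurableSet B) :
    ν B = ∫⁻ x in hazardDomain ν ∩ B, ENNReal.ofReal (t x) := by
  conv_lhs => rw [eq_withDensity_restrict_hazardDomain hd h0]
  rw [withDensity_apply _ hB, Measure.restrict_restrict hB, Set.inter_comm]

/-- The mean residual mass above `p` under a lower hazard bound. -/
lemma lintegral_survival_Ioi_le [NullSingletonClass ν]
    (hd : ν = volume.withDensity fun x => ENNReal.ofReal (t x)) (h0 : ν (Set.Iio 0) = 0)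
    {p : ℝ} (hp : 0 < p)
    (hhi : ∀ x ∈ hazardDomain ν, p < x → 1 / p ≤ t x / ν.real (Set.Ioi x)) :
    ∫⁻ x in Set.Ioi p, ν (Set.Ioi x) ≤ ENNReal.ofReal (p * ν.real (Set.Ioi p)) := by
  have hI := measurableSet_hazardDomain ν
  calc ∫⁻ x in Set.Ioi p, ν (Set.Ioi x)
      = ∫⁻ x in Set.Ioi p, (hazardDomain ν).indicator (fun x => ν (Set.Ioi x)) x := by
        refine setLIntegral_congr_fun measurableSet_Ioi fun x hx => ?_
        by_cases hxI : x ∈ hazardDomain ν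
        · simp [hxI]
        · simp only [hxI, not_false_eq_true, Set.indicator_of_notMem]
          rw [← measureReal_eq_zero_iff]
          by_contra hne
          exact hxI ⟨hp.le.trans (le_of_lt hx), lt_of_le_of_ne measureReal_nonneg (Ne.symm hne)⟩
    _ = ∫⁻ x in hazardDomain ν ∩ Set.Ioi p, ν (Set.Ioi x) := by
        rw [setLIntegral_indicator hI]
    _ ≤ ∫⁻ x in hazardDomain ν ∩ Set.Ioi p, ENNReal.ofReal p * ENNReal.ofReal (t x) := by
        refine setLIntegral_mono' (hI.inter measurableSet_Ioi) fun x hx => ?_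
        rw [← ofReal_measureReal, ← ENNReal.ofReal_mul hp.le]
        apply ENNReal.ofReal_le_ofReal
        have := hhi x hx.1 hx.2
        rw [div_le_div_iff₀ hp hx.1.2] at this
        linarith
    _ = ENNReal.ofReal p * ∫⁻ x in hazardDomain ν ∩ Set.Ioi p, ENNReal.ofReal (t x) :=
        lintegral_const_mul' _ _ ENNReal.ofReal_ne_top
    _ = ENNReal.ofReal (p * ν.real (Set.Ioi p)) := by
        rw [← measure_inter_hazardDomain_eq_lintegral hd h0 measurableSet_Ioi,
          ENNReal.ofReal_mul hp.le, ofReal_measureReal]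

/-- A linear Grönwall estimate for the survival function under an upper hazard bound. -/
lemma survival_le_add_integral [NullSingletonClass ν]
    (hd : ν = volume.withDensity fun x => ENNReal.ofReal (t x)) (h0 : ν (Set.Iio 0) = 0)
    {p : ℝ} (hp : 0 < p)
    (hlo : ∀ x ∈ hazardDomain ν, x < p → t x / ν.real (Set.Ioi x) ≤ 1 / p)
    {x : ℝ} (hxp : x ≤ p) :
    ν.real (Set.Ioi x) ≤ ν.real (Set.Ioi p) + 1 / p * ∫ y in x..p, ν.real (Set.Ioi y) := by
  have hI := measurableSet_hazardDomain ν
  have hint : IntegrableOn (fun y => ν.real (Set.Ioi y)) (Set.Ioo x p) :=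
    ((continuous_measureReal_Ioi ν).integrableOn_Icc (a := x) (b := p)).mono_set
      Set.Ioo_subset_Icc_self
  have h1 : ν (Set.Ioo x p) ≤ ENNReal.ofReal (1 / p * ∫ y in x..p, ν.real (Set.Ioi y)) := by
    rw [measure_inter_hazardDomain_eq_lintegral hd h0 measurableSet_Ioo]
    calc ∫⁻ y in hazardDomain ν ∩ Set.Ioo x p, ENNReal.ofReal (t y)
        ≤ ∫⁻ y in hazardDomain ν ∩ Set.Ioo x p, ENNReal.ofReal (1 / p * ν.real (Set.Ioi y)) := by
          refine setLIntegral_mono' (hI.inter measurableSet_Ioo) fun y hy => ?_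
          apply ENNReal.ofReal_le_ofReal
          have := hlo y hy.1 hy.2.2
          rwa [div_le_iff₀ hy.1.2] at this
      _ ≤ ∫⁻ y in Set.Ioo x p, ENNReal.ofReal (1 / p * ν.real (Set.Ioi y)) :=
          lintegral_mono_set Set.inter_subset_right
      _ = ENNReal.ofReal (1 / p * ∫ y in x..p, ν.real (Set.Ioi y)) := by
          rw [← ofReal_integral_eq_lintegral_ofReal (hint.const_mul _)
            (Filter.Eventually.of_forall fun y => by positivity), integral_const_mul,
            intervalIntegral.integral_of_le hxp, integral_Ioc_eq_integral_Ioo]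
  have hnn : 0 ≤ 1 / p * ∫ y in x..p, ν.real (Set.Ioi y) :=
    mul_nonneg (by positivity)
      (intervalIntegral.integral_nonneg hxp fun y _ => measureReal_nonneg)
  have h2 : ν.real (Set.Ioo x p) ≤ 1 / p * ∫ y in x..p, ν.real (Set.Ioi y) :=
    ENNReal.toReal_le_of_le_ofReal hnn h1
  have h3 : ν.real (Set.Ioi x) ≤ ν.real (Set.Ioo x p) + ν.real (Set.Ici p) := by
    refine (measureReal_mono ?_).trans (measureReal_union_le _ _)
    intro y hy
    rcases lt_or_ge y p with h | h
    · exact Or.inl ⟨hy, h⟩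
    · exact Or.inr h
  have h4 : ν.real (Set.Ici p) = ν.real (Set.Ioi p) :=
    congrArg ENNReal.toReal Ioi_ae_eq_Ici.measure_eq.symm
  linarith

lemma integral_survival_le [NullSingletonClass ν]
    (hd : ν = volume.withDensity fun x => ENNReal.ofReal (t x)) (h0 : ν (Set.Iio 0) = 0)
    {p : ℝ} (hp : 0 < p)
    (hlo : ∀ x ∈ hazardDomain ν, x < p → t x / ν.real (Set.Ioi x) ≤ 1 / p) :
    ∫ y in (0 : ℝ)..p, ν.real (Set.Ioi y) ≤ (Real.exp 1 - 1) * (p * ν.real (Set.Ioi p)) := by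
  set s : ℝ → ℝ := fun x => ν.real (Set.Ioi x) with hs
  have hc : Continuous s := continuous_measureReal_Ioi ν
  set G : ℝ → ℝ := fun x => ∫ y in x..p, s y with hG
  have hG' : ∀ x, HasDerivAt G (-s x) x := fun x =>
    intervalIntegral.integral_hasDerivAt_left (hc.intervalIntegrable _ _)
      hc.aestronglyMeasurable.stronglyMeasurableAtFilter hc.continuousAt
  have hu : ∀ x, HasDerivAt (fun x => Real.exp (x / p) * (G x + p * s p))
      (Real.exp (x / p) * (1 / p) * (G x + p * s p) + Real.exp (x / p) * (-s x)) x := fun x =>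
    (((hasDerivAt_id x).div_const p).exp).mul ((hG' x).add_const _)
  have hmono : MonotoneOn (fun x => Real.exp (x / p) * (G x + p * s p)) (Set.Icc 0 p) := by
    refine monotoneOn_of_deriv_nonneg (convex_Icc 0 p)
      (fun x _ => (hu x).continuousAt.continuousWithinAt)
      (fun x _ => (hu x).differentiableAt.differentiableWithinAt) fun x hx => ?_
    rw [interior_Icc] at hx
    rw [(hu x).deriv]
    have h1 : s x ≤ s p + 1 / p * G x := survival_le_add_integral hd h0 hp hlo hx.2.le
    have h2 : Real.exp (x / p) * (1 / p) * (G x + p * s p) + Real.exp (x / p) * (-s x)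
        = Real.exp (x / p) * (s p + 1 / p * G x - s x) := by
      field_simp
      ring
    rw [h2]
    exact mul_nonneg (Real.exp_pos _).le (by linarith)
  have h := hmono (Set.left_mem_Icc.2 hp.le) (Set.right_mem_Icc.2 hp.le) hp.le
  have hGp : G p = 0 := intervalIntegral.integral_same
  simp only [zero_div, Real.exp_zero, one_mul, div_self hp.ne', hGp, zero_add] at h
  change G 0 ≤ _
  linarith

lemma lintegral_survival_le [NullSingletonClass ν]
    (hd : ν = volume.withDensity fun x => ENNReal.ofReal (t x)) (h0 : ν (Set.Iio 0) = 0)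
    {p : ℝ} (hp : 0 < p)
    (hlo : ∀ x ∈ hazardDomain ν, x < p → t x / ν.real (Set.Ioi x) ≤ 1 / p)
    (hhi : ∀ x ∈ hazardDomain ν, p < x → 1 / p ≤ t x / ν.real (Set.Ioi x)) :
    ∫⁻ x in Set.Ioi 0, ν (Set.Ioi x)
      ≤ ENNReal.ofReal (Real.exp 1) * ENNReal.ofReal (p * ν.real (Set.Ioi p)) := by
  have hnn : 0 ≤ p * ν.real (Set.Ioi p) := by positivity
  have he : 0 ≤ Real.exp 1 - 1 := by
    have := Real.add_one_le_exp 1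
    linarith
  have hint : IntegrableOn (fun y => ν.real (Set.Ioi y)) (Set.Ioc 0 p) :=
    ((continuous_measureReal_Ioi ν).integrableOn_Icc (a := 0) (b := p)).mono_set
      Set.Ioc_subset_Icc_self
  have h1 : ∫⁻ x in Set.Ioc 0 p, ν (Set.Ioi x)
      ≤ ENNReal.ofReal ((Real.exp 1 - 1) * (p * ν.real (Set.Ioi p))) := by
    have : ∫⁻ x in Set.Ioc 0 p, ν (Set.Ioi x)
        = ENNReal.ofReal (∫ y in (0 : ℝ)..p, ν.real (Set.Ioi y)) := by
      rw [intervalIntegral.integral_of_le hp.le, ofReal_integral_eq_lintegral_ofReal hint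
        (Filter.Eventually.of_forall fun y => measureReal_nonneg)]
      simp
    rw [this]
    exact ENNReal.ofReal_le_ofReal (integral_survival_le hd h0 hp hlo)
  rw [← Set.Ioc_union_Ioi_eq_Ioi hp.le,
    lintegral_union measurableSet_Ioi (Set.Ioc_disjoint_Ioi le_rfl)]
  refine (add_le_add h1 (lintegral_survival_Ioi_le hd h0 hp hhi)).trans ?_
  rw [← ENNReal.ofReal_add (mul_nonneg he hnn) hnn, ← ENNReal.ofReal_mul (Real.exp_pos 1).le]
  exact ENNReal.ofReal_le_ofReal (by linarith)

lemma ae_mem_hazardDomain_and_pos [NullSingletonClass ν]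
    (hd : ν = volume.withDensity fun x => ENNReal.ofReal (t x)) (h0 : ν (Set.Iio 0) = 0)
    (ht : AEMeasurable t (volume.restrict (hazardDomain ν))) :
    ∀ᵐ x ∂ν, x ∈ hazardDomain ν ∧ 0 < t x := by
  have h1 : ∀ᵐ x ∂ν, x ∈ hazardDomain ν := measure_compl_hazardDomain h0
  have h2 : ∀ᵐ x ∂ν, 0 < t x := by
    rw [eq_withDensity_restrict_hazardDomain hd h0, ae_withDensity_iff' ht.ennreal_ofReal]
    exact Filter.Eventually.of_forall fun x hx => by
      by_contra h
      exact hx (ENNReal.ofReal_eq_zero.2 (not_lt.1 h))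
  exact h1.and h2

lemma aemeasurable_density_restrict
    (hM : MonotoneOn (fun x => t x / ν.real (Set.Ioi x)) (hazardDomain ν)) :
    AEMeasurable t (volume.restrict (hazardDomain ν)) := by
  have h1 := aemeasurable_restrict_of_monotoneOn (μ := volume) (measurableSet_hazardDomain ν) hM
  have h2 := h1.mul (measureReal_Ioi_antitone ν).measurable.aemeasurable
  refine h2.congr ?_
  filter_upwards [ae_restrict_mem (measurableSet_hazardDomain ν)] with x hx
  have := hx.2.ne'
  simp only [Pi.mul_apply]
  field_simp

lemma lintegral_id_restrict_Ioi {p : ℝ} (hp : 0 < p) :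
    ∫⁻ x in Set.Ioi p, ENNReal.ofReal x ∂ν
      = ENNReal.ofReal (p * ν.real (Set.Ioi p)) + ∫⁻ x in Set.Ioi p, ν (Set.Ioi x) := by
  have h := lintegral_eq_lintegral_meas_lt (ν.restrict (Set.Ioi p)) (f := fun x => x)
    (by filter_upwards [ae_restrict_mem measurableSet_Ioi] with x hx using hp.le.trans (le_of_lt hx))
    aemeasurable_id
  rw [h, ← Set.Ioc_union_Ioi_eq_Ioi hp.le,
    lintegral_union measurableSet_Ioi (Set.Ioc_disjoint_Ioi le_rfl)]
  congr 1
  · rw [setLIntegral_congr_fun (g := fun _ => ν (Set.Ioi p)) measurableSet_Ioc fun x hx => ?_]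
    · rw [setLIntegral_const, Real.volume_Ioc, sub_zero, ENNReal.ofReal_mul hp.le,
        ofReal_measureReal, mul_comm]
    · change (ν.restrict (Set.Ioi p)) (Set.Ioi x) = _
      rw [Measure.restrict_apply measurableSet_Ioi, Set.Ioi_inter_Ioi, sup_eq_right.2 hx.2]
  · refine setLIntegral_congr_fun measurableSet_Ioi fun x hx => ?_
    change (ν.restrict (Set.Ioi p)) (Set.Ioi x) = _
    rw [Measure.restrict_apply measurableSet_Ioi, Set.Ioi_inter_Ioi, sup_eq_left.2 (le_of_lt hx)]

/-- The expected positive part of the virtual value is at least the revenue of any posted price. -/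
lemma le_lintegral_virtual [NullSingletonClass ν]
    (hd : ν = volume.withDensity fun x => ENNReal.ofReal (t x)) (h0 : ν (Set.Iio 0) = 0)
    (ht : AEMeasurable t (volume.restrict (hazardDomain ν)))
    {p : ℝ} (hp : 0 < p) (hfin : ∫⁻ x in Set.Ioi p, ν (Set.Ioi x) ≠ ⊤) :
    ENNReal.ofReal (p * ν.real (Set.Ioi p))
      ≤ ∫⁻ x, ENNReal.ofReal (x - ν.real (Set.Ioi x) / t x) ∂ν := by
  have hsm : Measurable fun x => ν.real (Set.Ioi x) := (measureReal_Ioi_antitone ν).measurable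
  have htν : AEMeasurable t ν := by
    refine ht.mono_ac ?_
    conv_lhs => rw [eq_withDensity_restrict_hazardDomain hd h0]
    exact withDensity_absolutelyContinuous _ _
  have h1 : ∫⁻ x in Set.Ioi p, ENNReal.ofReal (ν.real (Set.Ioi x) / t x) ∂ν
      ≤ ∫⁻ x in Set.Ioi p, ν (Set.Ioi x) := by
    have hres : ν.restrict (Set.Ioi p) = (volume.restrict (Set.Ioi p ∩ hazardDomain ν)).withDensity
        fun x => ENNReal.ofReal (t x) := by
      conv_lhs => rw [eq_withDensity_restrict_hazardDomain hd h0]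
      rw [restrict_withDensity measurableSet_Ioi, Measure.restrict_restrict measurableSet_Ioi]
    rw [hres]
    have hsub : volume.restrict (Set.Ioi p ∩ hazardDomain ν) ≤ volume.restrict (hazardDomain ν) :=
      Measure.restrict_mono Set.inter_subset_right le_rfl
    have ht' := ht.mono_measure hsub
    have hm : AEMeasurable (fun x => ENNReal.ofReal (ν.real (Set.Ioi x) / t x))
        (volume.restrict (Set.Ioi p ∩ hazardDomain ν)) :=
      (hsm.aemeasurable.div ht').ennreal_ofReal
    rw [lintegral_withDensity_eq_lintegral_mul₀ ht'.ennreal_ofReal hm]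
    refine (lintegral_mono fun x => ?_).trans (lintegral_mono_set Set.inter_subset_left)
    simp only [Pi.mul_apply]
    rcases le_or_gt (t x) 0 with h | h
    · simp [ENNReal.ofReal_eq_zero.2 h]
    · rw [← ENNReal.ofReal_mul h.le, mul_div_cancel₀ _ h.ne', ofReal_measureReal]
  have h2 : ∫⁻ x in Set.Ioi p, ENNReal.ofReal x ∂ν
      ≤ ∫⁻ x in Set.Ioi p, ENNReal.ofReal (x - ν.real (Set.Ioi x) / t x) ∂ν
        + ∫⁻ x in Set.Ioi p, ENNReal.ofReal (ν.real (Set.Ioi x) / t x) ∂ν := by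
    have hm : AEMeasurable (fun x => ENNReal.ofReal (ν.real (Set.Ioi x) / t x))
        (ν.restrict (Set.Ioi p)) := (hsm.aemeasurable.div htν).ennreal_ofReal.restrict
    rw [← lintegral_add_right' _ hm]
    refine lintegral_mono fun x => ?_
    refine le_trans (ENNReal.ofReal_le_ofReal ?_) ENNReal.ofReal_add_le
    linarith
  rw [lintegral_id_restrict_Ioi hp] at h2
  have h3 := h2.trans (add_le_add_right h1 _)
  exact ((ENNReal.add_le_add_iff_right hfin).1 h3).trans (setLIntegral_le_lintegral _ _)

lemma ae_nonneg_of_measure_Iio {ν : Measure ℝ} (h0 : ν (Set.Iio 0) = 0) : ∀ᵐ x ∂ν, 0 ≤ x := by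
  rw [ae_iff]
  simpa [Set.Iio] using h0

lemma lintegral_id_eq_survival {ν : Measure ℝ} (h0 : ν (Set.Iio 0) = 0) :
    ∫⁻ x, ENNReal.ofReal x ∂ν = ∫⁻ x in Set.Ioi 0, ν (Set.Ioi x) :=
  lintegral_eq_lintegral_meas_lt ν (f := fun x => x)
    (ae_nonneg_of_measure_Iio h0) aemeasurable_id

lemma integrable_id_of_monotone_hazard [NullSingletonClass ν]
    (hd : ν = volume.withDensity fun x => ENNReal.ofReal (t x)) (h0 : ν (Set.Iio 0) = 0)
    (hM : MonotoneOn (fun x => t x / ν.real (Set.Ioi x)) (hazardDomain ν)) :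
    Integrable (fun x : ℝ => x) ν := by
  obtain ⟨p, hp, hlo, hhi⟩ := exists_hazard_crossing hd h0 hM
  refine (lintegral_ofReal_ne_top_iff_integrable aestronglyMeasurable_id
    (ae_nonneg_of_measure_Iio h0)).1 ?_
  change ∫⁻ x, ENNReal.ofReal x ∂ν ≠ ⊤
  rw [lintegral_id_eq_survival h0]
  exact ((lintegral_survival_le hd h0 hp hlo hhi).trans_lt
    (ENNReal.mul_lt_top ENNReal.ofReal_lt_top ENNReal.ofReal_lt_top)).ne

lemma aemeasurable_virtual [NullSingletonClass ν]
    (hd : ν = volume.withDensity fun x => ENNReal.ofReal (t x)) (h0 : ν (Set.Iio 0) = 0)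
    (hM : MonotoneOn (fun x => t x / ν.real (Set.Ioi x)) (hazardDomain ν)) :
    AEMeasurable (fun x => x - ν.real (Set.Ioi x) / t x) ν := by
  have htν : AEMeasurable t ν := by
    refine (aemeasurable_density_restrict hM).mono_ac ?_
    conv_lhs => rw [eq_withDensity_restrict_hazardDomain hd h0]
    exact withDensity_absolutelyContinuous _ _
  exact aemeasurable_id.sub ((measureReal_Ioi_antitone ν).measurable.aemeasurable.div htν)

lemma integrable_virtual_pos [NullSingletonClass ν]
    (hd : ν = volume.withDensity fun x => ENNReal.ofReal (t x)) (h0 : ν (Set.Iio 0) = 0)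
    (hM : MonotoneOn (fun x => t x / ν.real (Set.Ioi x)) (hazardDomain ν)) :
    Integrable (fun x => max (x - ν.real (Set.Ioi x) / t x) 0) ν := by
  refine (integrable_id_of_monotone_hazard hd h0 hM).mono
    ((aemeasurable_virtual hd h0 hM).max aemeasurable_const).aestronglyMeasurable ?_
  filter_upwards [ae_mem_hazardDomain_and_pos hd h0 (aemeasurable_density_restrict hM)] with x hx
  rw [Real.norm_of_nonneg (le_max_right _ _), Real.norm_of_nonneg hx.1.1]
  have : 0 ≤ ν.real (Set.Ioi x) / t x := div_nonneg measureReal_nonneg hx.2.le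
  exact max_le (by linarith) hx.1.1

/-- For a monotone hazard rate the optimal posted-price revenue is at least `1/e` of the mean. -/
lemma integral_id_div_exp_le [NullSingletonClass ν]
    (hd : ν = volume.withDensity fun x => ENNReal.ofReal (t x)) (h0 : ν (Set.Iio 0) = 0)
    (hM : MonotoneOn (fun x => t x / ν.real (Set.Ioi x)) (hazardDomain ν)) :
    ∫ x, x / Real.exp 1 ∂ν ≤ ∫ x, max (x - ν.real (Set.Ioi x) / t x) 0 ∂ν := by
  obtain ⟨p, hp, hlo, hhi⟩ := exists_hazard_crossing hd h0 hM
  have h1 := lintegral_survival_le hd h0 hp hlo hhi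
  have h2 := le_lintegral_virtual hd h0 (aemeasurable_density_restrict hM) hp
    ((lintegral_survival_Ioi_le hd h0 hp hhi).trans_lt ENNReal.ofReal_lt_top).ne
  have h3 : ∫⁻ x, ENNReal.ofReal (x - ν.real (Set.Ioi x) / t x) ∂ν
      = ENNReal.ofReal (∫ x, max (x - ν.real (Set.Ioi x) / t x) 0 ∂ν) := by
    rw [ofReal_integral_eq_lintegral_ofReal (integrable_virtual_pos hd h0 hM)
      (Filter.Eventually.of_forall fun x => le_max_right _ _)]
    simp
  rw [← lintegral_id_eq_survival h0, ← ofReal_integral_eq_lintegral_ofReal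
    (integrable_id_of_monotone_hazard hd h0 hM) (ae_nonneg_of_measure_Iio h0),
    ← ENNReal.ofReal_mul (Real.exp_pos 1).le] at h1
  have hI : 0 ≤ ∫ x, max (x - ν.real (Set.Ioi x) / t x) 0 ∂ν :=
    integral_nonneg fun x => le_max_right _ _
  rw [h3, ENNReal.ofReal_le_ofReal_iff hI] at h2
  rw [ENNReal.ofReal_le_ofReal_iff (mul_nonneg (Real.exp_pos 1).le (by positivity))] at h1
  rw [integral_div, div_le_iff₀ (Real.exp_pos 1), mul_comm]
  exact h1.trans (mul_le_mul_of_nonneg_left h2 (Real.exp_pos 1).le)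

/-- The gap between positive virtual value and `1/e` of the value changes sign at most once. -/
lemma virtual_gap_single_crossing {ν : Measure ℝ}
    (hM : MonotoneOn (fun x => t x / ν.real (Set.Ioi x)) (hazardDomain ν))
    {u v : ℝ} (hu : u ∈ hazardDomain ν) (hv : v ∈ hazardDomain ν) (htu : 0 < t u) (huv : u ≤ v)
    (hpos : 0 < max (u - ν.real (Set.Ioi u) / t u) 0 - u / Real.exp 1) :
    0 ≤ max (v - ν.real (Set.Ioi v) / t v) 0 - v / Real.exp 1 := by
  have hinv : ν.real (Set.Ioi v) / t v ≤ ν.real (Set.Ioi u) / t u := by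
    rw [← inv_div (t v), ← inv_div (t u)]
    exact inv_anti₀ (div_pos htu hu.2) (hM hu hv huv)
  have hu' : 0 ≤ u / Real.exp 1 := div_nonneg hu.1 (Real.exp_pos 1).le
  have h1 : 0 < u - ν.real (Set.Ioi u) / t u - u / Real.exp 1 := by
    rcases max_cases (u - ν.real (Set.Ioi u) / t u) 0 with h | h <;> linarith [h.1]
  have h2 : (v - u) / Real.exp 1 ≤ v - u :=
    div_le_self (sub_nonneg.2 huv) (Real.one_le_exp zero_le_one)
  rw [sub_div] at h2
  linarith [le_max_left (v - ν.real (Set.Ioi v) / t v) 0]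

/-- A single-crossing function dominates after reweighting by a monotone function. -/
lemma exists_const_mul_le_of_single_crossing {X g : ℝ → ℝ} {J : Set ℝ} {M : ℝ} (hX : Monotone X)
    (hX0 : ∀ v, 0 ≤ X v) (hXM : ∀ v, X v ≤ M)
    (hg : ∀ u ∈ J, ∀ v ∈ J, u ≤ v → 0 < g u → 0 ≤ g v) :
    ∃ c, 0 ≤ c ∧ ∀ v ∈ J, c * g v ≤ X v * g v := by
  rcases (J ∩ {v | 0 < g v}).eq_empty_or_nonempty with he | hne
  · refine ⟨M, (hX0 0).trans (hXM 0), fun v hv => mul_le_mul_of_nonpos_right (hXM v) ?_⟩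
    by_contra h
    exact Set.notMem_empty v (he ▸ ⟨hv, not_le.1 h⟩)
  have hbdd : BddBelow (X '' (J ∩ {v | 0 < g v})) := ⟨0, by rintro _ ⟨v, _, rfl⟩; exact hX0 v⟩
  refine ⟨sInf (X '' (J ∩ {v | 0 < g v})), le_csInf (hne.image X)
    (by rintro _ ⟨v, _, rfl⟩; exact hX0 v), fun v hv => ?_⟩
  rcases lt_trichotomy (g v) 0 with h | h | h
  · refine mul_le_mul_of_nonpos_right (le_csInf (hne.image X) ?_) h.le
    rintro _ ⟨u, hu, rfl⟩
    refine hX ?_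
    by_contra huv
    exact absurd (hg u hu.1 v hv (not_le.1 huv).le hu.2) (not_le.2 h)
  · simp [h]
  · exact mul_le_mul_of_nonneg_right (csInf_le hbdd ⟨v, ⟨hv, h⟩, rfl⟩) h.le

lemma integral_monotone_mul_virtual_gap_nonneg [NullSingletonClass ν]
    (hd : ν = volume.withDensity fun x => ENNReal.ofReal (t x)) (h0 : ν (Set.Iio 0) = 0)
    (hM : MonotoneOn (fun x => t x / ν.real (Set.Ioi x)) (hazardDomain ν))
    {X : ℝ → ℝ} {M : ℝ} (hX : Monotone X) (hX0 : ∀ v, 0 ≤ X v) (hXM : ∀ v, X v ≤ M) :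
    0 ≤ ∫ x, X x * (max (x - ν.real (Set.Ioi x) / t x) 0 - x / Real.exp 1) ∂ν := by
  have hi1 := integrable_virtual_pos hd h0 hM
  have hi2 := (integrable_id_of_monotone_hazard hd h0 hM).div_const (Real.exp 1)
  have hi := hi1.sub hi2
  obtain ⟨c, hc0, hc⟩ := exists_const_mul_le_of_single_crossing
    (g := fun x => max (x - ν.real (Set.Ioi x) / t x) 0 - x / Real.exp 1)
    (J := {x | x ∈ hazardDomain ν ∧ 0 < t x}) hX hX0 hXM
    fun u hu v hv huv => virtual_gap_single_crossing hM hu.1 hv.1 hu.2 huv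
  have h1 : 0 ≤ ∫ x, c * (max (x - ν.real (Set.Ioi x) / t x) 0 - x / Real.exp 1) ∂ν := by
    rw [integral_const_mul, integral_sub hi1 hi2]
    exact mul_nonneg hc0 (sub_nonneg.2 (integral_id_div_exp_le hd h0 hM))
  refine h1.trans (integral_mono_ae (hi.const_mul c) ?_ ?_)
  · refine hi.bdd_mul (c := M) hX.measurable.aestronglyMeasurable
      (Filter.Eventually.of_forall fun x => ?_)
    rw [Real.norm_of_nonneg (hX0 x)]
    exact hXM x
  · filter_upwards [ae_mem_hazardDomain_and_pos hd h0 (aemeasurable_density_restrict hM)] with x hx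
    exact hc x hx

end HazardRate

section Ranking

open PBM

variable {n : ℕ}

lemma measurable_rankAll (i : Fin n) : Measurable fun y : Fin n → ℝ => rankAll y i := by
  simp_rw [rankAll, Finset.card_filter]
  refine Finset.measurable_sum _ fun j _ => Measurable.ite ?_ measurable_const measurable_const
  have hi : Measurable fun y : Fin n → ℝ => y i := measurable_pi_apply i
  have hj : Measurable fun y : Fin n → ℝ => y j := measurable_pi_apply j
  exact (measurableSet_lt hi hj).union
    ((measurableSet_eq_fun hj hi).inter (MeasurableSet.const (j < i)))

lemma rankAll_le_of_le {x y : Fin n → ℝ} {i : Fin n} (hne : ∀ j, j ≠ i → y j = x j)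
    (hi : x i ≤ y i) : rankAll y i ≤ rankAll x i := by
  unfold rankAll
  refine Finset.card_le_card fun j hj => ?_
  simp only [Finset.mem_filter, Finset.mem_univ, true_and] at hj ⊢
  rcases eq_or_ne j i with rfl | hji
  · simp at hj
  rw [hne j hji] at hj
  rcases hj with h | ⟨h, hlt⟩
  · exact Or.inl (hi.trans_lt h)
  · rcases hi.lt_or_eq with h' | h'
    · exact Or.inl (h ▸ h')
    · exact Or.inr ⟨h.trans h'.symm, hlt⟩

lemma integrable_rank_weight_mul {ν : Measure ℝ} [IsProbabilityMeasure ν] {w : ℕ → ℝ}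
    (hw : Antitone w) (hw0 : ∀ k, 0 ≤ w k) {f : ℝ → ℝ} (hf : Integrable f ν) (i : Fin n) :
    Integrable (fun y => w (rankAll y i) * f (y i)) (Measure.pi fun _ : Fin n => ν) := by
  have h1 : Integrable (fun y : Fin n → ℝ => f (y i)) (Measure.pi fun _ : Fin n => ν) :=
    (measurePreserving_eval (fun _ : Fin n => ν) i).integrable_comp_of_integrable hf
  refine h1.bdd_mul (c := w 0)
    ((measurable_from_nat (f := w)).comp (measurable_rankAll i)).aestronglyMeasurable
    (Filter.Eventually.of_forall fun y => ?_)
  rw [Real.norm_of_nonneg (hw0 _)]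
  exact hw (Nat.zero_le _)

/-- An i.i.d. ranking integral is nonnegative if every monotone reweighting of `g` is. -/
lemma integral_rank_weight_mul_nonneg {ν : Measure ℝ} [IsProbabilityMeasure ν] {w : ℕ → ℝ}
    (hw : Antitone w) (hw0 : ∀ k, 0 ≤ w k) {g : ℝ → ℝ} (hg : Integrable g ν)
    (hmono : ∀ X : ℝ → ℝ, Monotone X → (∀ v, 0 ≤ X v) → (∀ v, X v ≤ w 0) →
      0 ≤ ∫ x, X x * g x ∂ν) (i : Fin n) :
    0 ≤ ∫ y, w (rankAll y i) * g (y i) ∂(Measure.pi fun _ : Fin n => ν) := by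
  cases n with
  | zero => exact i.elim0
  | succ m =>
    have hmp := (measurePreserving_piFinSuccAbove (fun _ : Fin (m + 1) => ν) i).symm
    have hint := integrable_rank_weight_mul hw hw0 hg i
    rw [← hmp.integral_comp (MeasurableEquiv.measurableEmbedding _)]
    rw [← hmp.integrable_comp_emb (MeasurableEquiv.measurableEmbedding _)] at hint
    refine le_of_le_of_eq (integral_nonneg fun z => ?_) (integral_prod_symm _ hint).symm
    have hsymm : ∀ x : ℝ, (MeasurableEquiv.piFinSuccAbove (fun _ : Fin (m + 1) => ℝ) i).symm (x, z)
        = Fin.insertNth (α := fun _ => ℝ) i x z := fun x => rfl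
    simp only [Function.comp_apply, hsymm, Fin.insertNth_apply_same]
    refine hmono _ (fun a b hab => hw (rankAll_le_of_le (fun j hj => ?_) ?_)) (fun _ => hw0 _)
      fun _ => hw (Nat.zero_le _)
    · obtain ⟨k, rfl⟩ := Fin.exists_succAbove_eq hj
      simp
    · simpa using hab

end Ranking

section KeywordMarginal

open PBM

variable {S : Type*}

lemma one_sub_cdfT_eq (T : Measure (S → ℝ)) [IsProbabilityMeasure T] (s : S) (x : ℝ) :
    1 - cdfT T s x = (T.map fun f => f s).real (Set.Ioi x) := by
  have : IsProbabilityMeasure (T.map fun f => f s) :=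
    Measure.isProbabilityMeasure_map (measurable_pi_apply s).aemeasurable
  rw [← Set.compl_Iic, probReal_compl_eq_one_sub measurableSet_Iic]
  rfl

lemma aemeasurable_of_map_isProbabilityMeasure {α β : Type*} [MeasurableSpace α]
    [MeasurableSpace β] {μ : Measure α} {f : α → β} [h : IsProbabilityMeasure (μ.map f)] :
    AEMeasurable f μ := by
  by_contra hf
  have h1 := h.measure_univ
  rw [Measure.map_of_not_aemeasurable hf] at h1
  simp at h1

/-- The values of all bidders on a single keyword are i.i.d. with the marginal law. -/
lemma map_keyword_eq_pi {n : ℕ} {T : Measure (S → ℝ)} [IsProbabilityMeasure T]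
    {Ω : Type*} [MeasurableSpace Ω] {μ : Measure Ω} {K : Ω → Fin n → S → ℝ}
    (hK : μ.map K = Measure.pi fun _ => T) (s : S) :
    μ.map (fun ω i => K ω i s) = Measure.pi fun _ : Fin n => T.map fun f => f s := by
  have : IsProbabilityMeasure (μ.map K) := hK ▸ inferInstance
  have hm : Measurable fun (y : Fin n → S → ℝ) (i : Fin n) => y i s := by fun_prop
  have h1 := AEMeasurable.map_map_of_aemeasurable (μ := μ) (f := K) hm.aemeasurable
    aemeasurable_of_map_isProbabilityMeasure
  have : IsProbabilityMeasure (T.map fun f => f s) :=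
    Measure.isProbabilityMeasure_map (measurable_pi_apply s).aemeasurable
  rw [hK, Measure.pi_map_pi fun _ => (measurable_pi_apply s).aemeasurable] at h1
  exact h1.symm

variable {Q : Type*} [Fintype Q]

lemma SWtruth_eq_sum_mass [Fintype S] {n : ℕ} (P : Q → ℝ) (pi : Q → S → ℝ) (w : ℕ → ℝ)
    (v : Fin n → Q → ℝ) :
    SWtruth P pi w v = ∑ s, mass P pi s *
      ∑ i, w (rankAll (fun j => kwVal P pi (v j) s) i) * kwVal P pi (v i) s := by
  simp only [SWtruth, mass, Finset.mul_sum, Finset.sum_mul]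
  rw [Finset.sum_comm]
  refine Finset.sum_congr rfl fun s _ => ?_
  rw [Finset.sum_comm]
  refine Finset.sum_congr rfl fun i _ => Finset.sum_congr rfl fun q _ => ?_
  ring

lemma kwVal_nonneg {P : Q → ℝ} {pi : Q → S → ℝ} (hP0 : ∀ q, 0 ≤ P q)
    (hpi0 : ∀ q s, 0 ≤ pi q s) {v : Q → ℝ} (hv : ∀ q, 0 ≤ v q) (s : S) :
    0 ≤ kwVal P pi v s :=
  div_nonneg (Finset.sum_nonneg fun q _ => mul_nonneg (mul_nonneg (hpi0 q s) (hv q)) (hP0 q))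
    (Finset.sum_nonneg fun q _ => mul_nonneg (hpi0 q s) (hP0 q))

/-- The contribution of one bidder on one keyword to revenue minus `1/e` of the welfare. -/
lemma integral_keyword_gap {n : ℕ} {w : ℕ → ℝ} (hw : Antitone w) (hw0 : ∀ k, 0 ≤ w k)
    {T : Measure (S → ℝ)} [IsProbabilityMeasure T] {td : S → ℝ → ℝ}
    (hdens : HasDensity T td) (hMHR : MHRhazard T td)
    {Ω : Type*} [MeasurableSpace Ω] {μ : Measure Ω} {K : Ω → Fin n → S → ℝ}
    (hK : μ.map K = Measure.pi fun _ => T) (hK0 : ∀ ω i s, 0 ≤ K ω i s) (s : S) (i : Fin n) :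
    Integrable (fun ω => w (rankAll (fun j => K ω j s) i) *
        (max (virt T td s (K ω i s)) 0 - K ω i s / Real.exp 1)) μ ∧
      0 ≤ ∫ ω, w (rankAll (fun j => K ω j s) i) *
        (max (virt T td s (K ω i s)) 0 - K ω i s / Real.exp 1) ∂μ := by
  have hmap := map_keyword_eq_pi hK s
  have hcdf := one_sub_cdfT_eq T s
  have hvirt : ∀ x, virt T td s x
      = x - (T.map fun f => f s).real (Set.Ioi x) / td s x := fun x => by rw [virt, hcdf]
  have hd := hdens s
  have hM := hMHR s
  have hprob : IsProbabilityMeasure (T.map fun f => f s) :=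
    Measure.isProbabilityMeasure_map (measurable_pi_apply s).aemeasurable
  have hdom : {x : ℝ | 0 ≤ x ∧ cdfT T s x < 1} = hazardDomain (T.map fun f => f s) := by
    ext x
    simp only [hazardDomain, Set.mem_ofPred_eq, ← hcdf, sub_pos]
  simp only [hcdf, hdom] at hM
  simp only [hvirt]
  generalize (T.map fun f => f s) = ν at *
  have hatom : NullSingletonClass ν :=
    ⟨fun x => by rw [hd]; exact withDensity_absolutelyContinuous _ _ (by simp)⟩
  have hpi : IsProbabilityMeasure (μ.map fun ω i => K ω i s) := hmap ▸ inferInstance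
  have hKm : AEMeasurable (fun ω i => K ω i s) μ := aemeasurable_of_map_isProbabilityMeasure
  have h0 : ν (Set.Iio 0) = 0 := by
    have h := (measurePreserving_eval (fun _ : Fin n => ν) i).measure_preimage
      (measurableSet_Iio (a := (0 : ℝ))).nullMeasurableSet
    rw [← h, ← hmap, Measure.map_apply_of_aemeasurable hKm
      (measurable_pi_apply i measurableSet_Iio)]
    convert measure_empty (μ := μ)
    ext ω
    simpa using hK0 ω i s
  have hg : Integrable (fun x => max (x - ν.real (Set.Ioi x) / td s x) 0 - x / Real.exp 1) ν :=
    (integrable_virtual_pos hd h0 hM).sub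
      ((integrable_id_of_monotone_hazard hd h0 hM).div_const _)
  have hint := integrable_rank_weight_mul hw hw0 hg i
  have hnn := integral_rank_weight_mul_nonneg hw hw0 hg
    (fun X h1 h2 h3 => integral_monotone_mul_virtual_gap_nonneg hd h0 hM h1 h2 h3) i
  rw [← hmap] at hint hnn
  rw [integral_map hKm hint.aestronglyMeasurable] at hnn
  exact ⟨hint.comp_aemeasurable hKm, hnn⟩

end KeywordMarginal


open PBM in
/-- with keyword valuations i.i.d. from an MHR distribution `T`
and `r` the Myerson reserve prices, the expected revenue of PBM-VCG with
reserves `r` is at least a `1/e` fraction of the expected welfare of the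
truthful keyword allocation `𝔳`. -/
theorem stmt15
    {Q S : Type*} [Fintype Q] [Fintype S] {n : ℕ}
    (P : Q → ℝ) (pi : Q → S → ℝ) (w : ℕ → ℝ)
    (hP0 : ∀ q, 0 ≤ P q) (hP1 : ∑ q, P q = 1)
    (hpi0 : ∀ q s, 0 ≤ pi q s) (hpi1 : ∀ q, ∑ s, pi q s = 1)
    (hS : ∀ s : S, ∃ q, 0 < pi q s)
    (hw : Antitone w) (hw0 : ∀ k, 0 ≤ w k)
    (T : Measure (S → ℝ)) [IsProbabilityMeasure T]
    (td : S → ℝ → ℝ) (r : S → ℝ)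
    (hdens : HasDensity T td)
    (hMHR : MHRhazard T td)
    (hres : MyersonReserve T td r)
    {Ω : Type*} [MeasurableSpace Ω] (μ : Measure Ω) [IsProbabilityMeasure μ]
    (Vf : Ω → Fin n → Q → ℝ) (hV0 : ∀ ω i q, 0 ≤ Vf ω i q)
    (hlaw : Measure.map (fun ω => fun (i : Fin n) (s : S) => kwVal P pi (Vf ω i) s) μ
        = Measure.pi fun _ : Fin n => T)
    (hIntVCG : Integrable (fun ω => revVCG P pi w T td (Vf ω)) μ)
    (hIntTr : Integrable (fun ω => SWtruth P pi w (Vf ω)) μ) :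
    (1 / Real.exp 1) * ∫ ω, SWtruth P pi w (Vf ω) ∂μ
      ≤ ∫ ω, revVCG P pi w T td (Vf ω) ∂μ := by
  have hgap := fun s i => integral_keyword_gap hw hw0 hdens hMHR hlaw
    (fun ω i s => kwVal_nonneg hP0 hpi0 (hV0 ω i) s) s i
  rw [← sub_nonneg, ← integral_const_mul, ← integral_sub hIntVCG (hIntTr.const_mul _)]
  have heq : ∀ ω, revVCG P pi w T td (Vf ω) - 1 / Real.exp 1 * SWtruth P pi w (Vf ω)
      = ∑ s, mass P pi s * ∑ i, w (rankAll (fun j => kwVal P pi (Vf ω j) s) i) *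
        (max (virt T td s (kwVal P pi (Vf ω i) s)) 0 - kwVal P pi (Vf ω i) s / Real.exp 1) := by
    intro ω
    rw [SWtruth_eq_sum_mass, revVCG, Finset.mul_sum, ← Finset.sum_sub_distrib]
    refine Finset.sum_congr rfl fun s _ => ?_
    rw [mul_left_comm, ← mul_sub, Finset.mul_sum, ← Finset.sum_sub_distrib]
    refine congrArg _ (Finset.sum_congr rfl fun i _ => ?_)
    split_ifs with h
    · rw [max_eq_left h.le]
      ring
    · rw [max_eq_right (not_lt.1 h)]
      ring
  simp only [heq]
  rw [integral_finsetSum _ fun s _ =>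
    (integrable_finsetSum _ fun i _ => (hgap s i).1).const_mul _]
  refine Finset.sum_nonneg fun s _ => ?_
  rw [integral_const_mul, integral_finsetSum _ fun i _ => (hgap s i).1]
  exact mul_nonneg (Finset.sum_nonneg fun q _ => mul_nonneg (hpi0 q s) (hP0 q))
    (Finset.sum_nonneg fun i _ => (hgap s i).2)
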